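/- Let G be a closed subgroup of U(m) (m ≥ 2) that is connected and has dimension at least m² - 1. Then dim G = m² - 1 or m², i.e., G equals SU(m) or U(m) up to conjugacy; in particular G acts irreducibly on ℂ^m by the standard representation. -/

import Mathlib

open scoped ENNReal

/-- The image of a subgroup of the unitary group in the ambient (metric) space of
matrix entries, used to measure its dimension via Hausdorff dimension. -/
noncomputable def unitarySubgroupCarrier (m : ℕ)
    (G : Subgroup (Matrix.unitaryGroup (Fin m) ℂ)) : Set (Fin m → Fin m → ℂ) :=
  (fun A : Matrix.unitaryGroup (Fin m) ℂ =>
    fun i j => (A : Matrix (Fin m) (Fin m) ℂ) i j) '' (G : Set (Matrix.unitaryGroup (Fin m) ℂ))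

namespace Stmt9

open Filter Topology NormedSpace


section Generic

variable {A : Type*} [CStarAlgebra A]

/-- A closed set of unitaries that is a group. -/
structure CG (S : Set A) : Prop where
  closed : IsClosed S
  one : (1 : A) ∈ S
  mul : ∀ g ∈ S, ∀ h ∈ S, g * h ∈ S
  star : ∀ g ∈ S, star g ∈ S
  unit : ∀ g ∈ S, g ∈ unitary A

lemma norm_le_one_of_unitary {u : A} (hu : u ∈ unitary A) : ‖u‖ ≤ 1 := by
  rcases subsingleton_or_nontrivial A with h | h
  · simp [Subsingleton.elim u 0]
  · exact (CStarRing.norm_of_mem_unitary hu).le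

lemma norm_pow_sub_pow_le (a b : A) (ha : ‖a‖ ≤ 1) (hb : ‖b‖ ≤ 1) (n : ℕ) :
    ‖a ^ n - b ^ n‖ ≤ n * ‖a - b‖ := by
  have h1 : ∀ n, ‖b ^ n‖ ≤ 1 := by
    intro n
    rcases subsingleton_or_nontrivial A with h | h
    · simp [Subsingleton.elim (b ^ n) 0]
    · exact (norm_pow_le b n).trans (pow_le_one₀ (norm_nonneg _) hb)
  induction n with
  | zero => simp
  | succ n ih =>
    have : a ^ (n + 1) - b ^ (n + 1) = a * (a ^ n - b ^ n) + (a - b) * b ^ n := by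
      rw [pow_succ', pow_succ']; noncomm_ring
    rw [this]
    calc _ ≤ ‖a‖ * ‖a ^ n - b ^ n‖ + ‖a - b‖ * ‖b ^ n‖ :=
          (norm_add_le _ _).trans (add_le_add (norm_mul_le _ _) (norm_mul_le _ _))
      _ ≤ 1 * (n * ‖a - b‖) + ‖a - b‖ * 1 := by
          gcongr
          exact h1 n
      _ = _ := by push_cast; ring

lemma tendsto_exp_slope (X : A) {c : ℕ → ℝ} (hc : Tendsto c atTop atTop) :
    Tendsto (fun k => c k • (exp ((c k)⁻¹ • X) - 1)) atTop (𝓝 X) := by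
  have h := (hasDerivAt_iff_tendsto_slope_zero).1 (hasDerivAt_exp_smul_const (𝕂 := ℝ) X 0)
  have h2 : Tendsto (fun k => (c k)⁻¹) atTop (𝓝[≠] 0) := by
    refine tendsto_nhdsWithin_iff.2 ⟨tendsto_inv_atTop_zero.comp hc, ?_⟩
    filter_upwards [hc.eventually_gt_atTop 0] with k hk
    simpa using hk.ne'
  simpa [Function.comp_def] using h.comp h2

lemma tendsto_one_of_smul {g : ℕ → A} {c : ℕ → ℝ} (hc : Tendsto c atTop atTop) {X : A}
    (h : Tendsto (fun k => c k • (g k - 1)) atTop (𝓝 X)) : Tendsto g atTop (𝓝 1) := by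
  have h1 := (tendsto_inv_atTop_zero.comp hc).smul h
  have h2 : Tendsto (fun k => g k - 1) atTop (𝓝 0) := by
    rw [zero_smul] at h1
    refine h1.congr' ?_
    filter_upwards [hc.eventually_gt_atTop 0] with k hk
    simp [smul_smul, inv_mul_cancel₀ hk.ne']
  simpa using h2.add_const 1

lemma skew_of_tendsto {g : ℕ → A} {c : ℕ → ℝ} (hg : ∀ k, g k ∈ unitary A)
    (hc : Tendsto c atTop atTop) {X : A}
    (h : Tendsto (fun k => c k • (g k - 1)) atTop (𝓝 X)) : X ∈ skewAdjoint A := by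
  have h1 := tendsto_one_of_smul hc h
  have h2 : Tendsto (fun k => star (c k • (g k - 1))) atTop (𝓝 (star X)) := h.star
  have h3 : Tendsto (fun k => - (star (g k) * (c k • (g k - 1)))) atTop (𝓝 (-(star 1 * X))) :=
    ((h1.star).mul h).neg
  rw [skewAdjoint.mem_iff]
  refine tendsto_nhds_unique h2 ?_
  simp only [star_one, one_mul] at h3
  refine h3.congr fun k => ?_
  have := (Unitary.mem_iff.1 (hg k)).1
  rw [mul_smul_comm, mul_sub, this, star_smul, star_sub, star_one, ← smul_neg, neg_sub, mul_one]
  simp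

lemma exp_unitary {X : A} (hX : X ∈ skewAdjoint A) : exp X ∈ unitary A := by
  let _ := NormedAlgebra.restrictScalars ℚ ℂ A
  exact exp_mem_unitary_of_mem_skewAdjoint hX

lemma exp_mem_of_tendsto {S : Set A} (hS : CG S) {g : ℕ → A} {c : ℕ → ℝ} (hg : ∀ k, g k ∈ S)
    (hc : Tendsto c atTop atTop) {X : A}
    (h : Tendsto (fun k => c k • (g k - 1)) atTop (𝓝 X)) : exp X ∈ S := by
  let _ := NormedAlgebra.restrictScalars ℚ ℂ A
  have hX : X ∈ skewAdjoint A := skew_of_tendsto (fun k => hS.unit _ (hg k)) hc h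
  let n : ℕ → ℕ := fun k => ⌊c k⌋₊
  have hn : Tendsto n atTop atTop := tendsto_nat_floor_atTop.comp hc
  have hnR : Tendsto (fun k => (n k : ℝ)) atTop atTop := tendsto_natCast_atTop_atTop.comp hn
  have hr : Tendsto (fun k => (n k : ℝ) / c k) atTop (𝓝 1) := tendsto_nat_floor_div_atTop.comp hc
  have h1 : Tendsto (fun k => (n k : ℝ) • (g k - 1)) atTop (𝓝 X) := by
    have := hr.smul h
    rw [one_smul] at this
    refine this.congr' ?_
    filter_upwards [hc.eventually_gt_atTop 0] with k hk
    rw [smul_smul, div_mul_cancel₀ _ hk.ne']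
  have h2 := tendsto_exp_slope X hnR
  have h3 : Tendsto (fun k => (n k : ℝ) * ‖g k - exp ((n k : ℝ)⁻¹ • X)‖) atTop (𝓝 0) := by
    have := (h1.sub h2).norm
    rw [sub_self, norm_zero] at this
    refine this.congr fun k => ?_
    rw [← smul_sub, norm_smul]
    simp
  have hsk : ∀ t : ℝ, t • X ∈ skewAdjoint A := fun t => skewAdjoint.smul_mem t hX
  have h4 : Tendsto (fun k => g k ^ n k - exp X) atTop (𝓝 0) := by
    refine squeeze_zero_norm' ?_ h3
    filter_upwards [hn.eventually_gt_atTop 0] with k hk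
    have : exp X = exp ((n k : ℝ)⁻¹ • X) ^ n k := by
      rw [← exp_nsmul, ← Nat.cast_smul_eq_nsmul ℝ, smul_smul,
        mul_inv_cancel₀ (by exact_mod_cast hk.ne'), one_smul]
    rw [this]
    exact norm_pow_sub_pow_le _ _ (norm_le_one_of_unitary (hS.unit _ (hg k)))
      (norm_le_one_of_unitary (exp_unitary (hsk _))) _
  have h5 : Tendsto (fun k => g k ^ n k) atTop (𝓝 (exp X)) := by
    simpa using h4.add_const (exp X)
  refine hS.closed.mem_of_tendsto h5 (Eventually.of_forall fun k => ?_)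
  generalize n k = j
  induction j with
  | zero => simpa using hS.one
  | succ j ih => rw [pow_succ]; exact hS.mul _ ih _ (hg k)

/-- The defining property of the Lie algebra. -/
def lieSet (S : Set A) : Set A := {X | ∀ t : ℝ, exp (t • X) ∈ S}

lemma mem_lieSet_of_tendsto {S : Set A} (hS : CG S) {g : ℕ → A} {c : ℕ → ℝ} (hg : ∀ k, g k ∈ S)
    (hc : Tendsto c atTop atTop) {X : A}
    (h : Tendsto (fun k => c k • (g k - 1)) atTop (𝓝 X)) : X ∈ lieSet S := by
  have hX : X ∈ skewAdjoint A := skew_of_tendsto (fun k => hS.unit _ (hg k)) hc h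
  have key : ∀ t : ℝ, 0 < t → exp (t • X) ∈ S := by
    intro t ht
    refine exp_mem_of_tendsto hS (c := fun k => t * c k) hg (hc.const_mul_atTop ht) ?_
    simpa [smul_smul] using h.const_smul t
  intro t
  rcases lt_trichotomy t 0 with ht | rfl | ht
  · have h1 := hS.star _ (key (-t) (by linarith))
    rw [star_exp, star_smul, (skewAdjoint.mem_iff).1 hX] at h1
    simpa using h1
  · simpa using hS.one
  · exact key t ht

lemma skew_of_mem_lieSet {S : Set A} (hS : CG S) {X : A} (hX : X ∈ lieSet S) :
    X ∈ skewAdjoint A := by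
  have hc : Tendsto (fun k : ℕ => (k : ℝ)) atTop atTop := tendsto_natCast_atTop_atTop
  exact skew_of_tendsto (g := fun k : ℕ => exp ((k : ℝ)⁻¹ • X)) (fun k => hS.unit _ (hX _)) hc
    (tendsto_exp_slope X hc)

/-- The Lie algebra of a closed group of unitaries. -/
def lieAlg (S : Set A) (hS : CG S) : Submodule ℝ A where
  carrier := lieSet S
  zero_mem' := fun t => by simpa using hS.one
  smul_mem' := fun r X hX t => by rw [smul_smul]; exact hX _
  add_mem' := by
    intro X Y hX hY
    have hc : Tendsto (fun k : ℕ => (k : ℝ)) atTop atTop := tendsto_natCast_atTop_atTop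
    refine mem_lieSet_of_tendsto hS (c := fun k : ℕ => (k : ℝ))
      (g := fun k : ℕ => exp ((k : ℝ)⁻¹ • X) * exp ((k : ℝ)⁻¹ • Y))
      (fun k => hS.mul _ (hX _) _ (hY _)) hc ?_
    have h1 := tendsto_exp_slope X hc
    have h2 := tendsto_exp_slope Y hc
    have h3 := tendsto_one_of_smul hc h2
    have h4 := (h1.mul h3).add h2
    rw [mul_one] at h4
    refine h4.congr fun k => ?_
    rw [smul_mul_assoc, ← smul_add]
    congr 1
    noncomm_ring

lemma mem_lieAlg {S : Set A} {hS : CG S} {X : A} :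
    X ∈ lieAlg S hS ↔ ∀ t : ℝ, exp (t • X) ∈ S := Iff.rfl

lemma conj_mem {S : Set A} (hS : CG S) {X g : A} (hX : X ∈ lieAlg S hS) (hg : g ∈ S) :
    g * X * star g ∈ lieAlg S hS := by
  let _ := NormedAlgebra.restrictScalars ℚ ℂ A
  intro t
  have hu := Unitary.mem_iff.1 (hS.unit g hg)
  let u : Aˣ := ⟨g, star g, hu.2, hu.1⟩
  have := exp_units_conj u (t • X)
  have h2 : t • (g * X * star g) = u * (t • X) * ↑u⁻¹ := by
    simp [u]
  rw [h2, this]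
  exact hS.mul _ (hS.mul _ hg _ (hX t)) _ (hS.star _ hg)

variable [FiniteDimensional ℝ A]

lemma bracket_mem {S : Set A} (hS : CG S) {X Y : A} (hX : X ∈ lieAlg S hS)
    (hY : Y ∈ lieAlg S hS) : Y * X - X * Y ∈ lieAlg S hS := by
  have hc : Tendsto (fun k : ℕ => (k : ℝ)) atTop atTop := tendsto_natCast_atTop_atTop
  have hcl : IsClosed ((lieAlg S hS : Submodule ℝ A) : Set A) :=
    Submodule.closed_of_finiteDimensional _
  have h2 := tendsto_exp_slope Y hc
  have h3 := tendsto_one_of_smul hc h2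
  have hsk := (skewAdjoint.mem_iff).1 (skew_of_mem_lieSet hS hY)
  have h2' := h2.star
  have h5 := ((h2.mul_const X).mul h3.star).add (h2'.const_mul X)
  rw [hsk, star_one, mul_one, mul_neg, ← sub_eq_add_neg] at h5
  refine hcl.mem_of_tendsto h5 (Eventually.of_forall fun k => ?_)
  have hk := Submodule.smul_mem _ (k : ℝ)
    (Submodule.sub_mem _ (conj_mem hS hX (hY (k : ℝ)⁻¹)) hX)
  convert! hk using 1
  rw [star_smul, star_sub, star_one]
  simp only [star_trivial, smul_mul_assoc, mul_smul_comm]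
  rw [← smul_add]
  congr 1
  noncomm_ring

lemma exists_lower {S : Set A} (hS : CG S) (π : A →ₗ[ℝ] lieAlg S hS)
    (hπ : ∀ x : lieAlg S hS, π x = x) :
    ∃ c > 0, ∀ g ∈ S, ‖g - 1‖ < c → c * ‖g - 1‖ ≤ ‖π (g - 1)‖ := by
  by_contra! hcon
  have hpos : ∀ k : ℕ, (0 : ℝ) < 1 / ((k : ℝ) + 1) := fun k => by positivity
  choose g hgS hg1 hg2 using fun k : ℕ => hcon _ (hpos k)
  have hne : ∀ k, g k - 1 ≠ 0 := by
    intro k h0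
    have := hg2 k
    simp [h0] at this
  have hnp : ∀ k, 0 < ‖g k - 1‖ := fun k => norm_pos_iff.2 (hne k)
  let v : ℕ → A := fun k => ‖g k - 1‖⁻¹ • (g k - 1)
  have hv : ∀ k, v k ∈ Metric.sphere (0 : A) 1 := by
    intro k
    simp [v, norm_smul, (hnp k).ne']
  have : ProperSpace A := FiniteDimensional.proper ℝ A
  obtain ⟨x, hx, φ, hφ, hlim⟩ := (isCompact_sphere (0 : A) 1).tendsto_subseq hv
  have hz : Tendsto (fun k => ‖g k - 1‖) atTop (𝓝 0) :=
    squeeze_zero (fun k => norm_nonneg _) (fun k => (hg1 k).le) tendsto_one_div_add_atTop_nhds_zero_nat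
  have hc : Tendsto (fun k => ‖g (φ k) - 1‖⁻¹) atTop atTop := by
    refine tendsto_inv_nhdsGT_zero.comp (tendsto_nhdsWithin_iff.2 ⟨hz.comp hφ.tendsto_atTop, ?_⟩)
    exact Eventually.of_forall fun k => hnp _
  have hmem : x ∈ lieAlg S hS :=
    mem_lieSet_of_tendsto hS (g := fun k => g (φ k)) (fun k => hgS _) hc hlim
  have hcont : Continuous π := LinearMap.continuous_of_finiteDimensional π
  have h1 : Tendsto (fun k => ‖π (v (φ k))‖) atTop (𝓝 ‖π x‖) :=
    ((hcont.tendsto x).comp hlim).norm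
  have h2 : Tendsto (fun k => ‖π (v (φ k))‖) atTop (𝓝 0) := by
    refine squeeze_zero (fun k => norm_nonneg _) (fun k => ?_)
      (tendsto_one_div_add_atTop_nhds_zero_nat.comp hφ.tendsto_atTop)
    simp only [v, map_smul, norm_smul, norm_inv, norm_norm, Function.comp]
    rw [inv_mul_le_iff₀ (hnp _), mul_comm]
    exact (hg2 _).le
  have h3 : π x = ⟨x, hmem⟩ := hπ ⟨x, hmem⟩
  have h4 := tendsto_nhds_unique h1 h2
  rw [h3] at h4
  have h5 : ‖x‖ = 0 := h4
  simp [h5] at hx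

lemma dimH_le_finrank {S : Set A} (hS : CG S) :
    dimH S ≤ (Module.finrank ℝ (lieAlg S hS) : ENNReal) := by
  obtain ⟨π, hπ'⟩ := LinearMap.exists_leftInverse_of_injective (lieAlg S hS).subtype
    (Submodule.ker_subtype _)
  have hπ : ∀ x : lieAlg S hS, π x = x := fun x => by
    simpa using LinearMap.congr_fun hπ' x
  obtain ⟨c, hc, hlow⟩ := exists_lower hS π hπ
  let P : A →L[ℝ] lieAlg S hS := LinearMap.toContinuousLinearMap π
  have hP : ∀ x, P x = π x := fun x => rfl
  by_contra! hlt
  have : ProperSpace A := FiniteDimensional.proper ℝ A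
  obtain ⟨h, hh, hnb⟩ := exists_mem_nhdsWithin_lt_dimH_of_lt_dimH hlt
  obtain ⟨ε, hε, hε1, hε2⟩ : ∃ ε > 0, 2 * ε ≤ c ∧ ‖P‖ * ε ≤ c / 2 := by
    refine ⟨min (c / 2) (c / 2 / (‖P‖ + 1)), by positivity, ?_, ?_⟩
    · have := min_le_left (c / 2) (c / 2 / (‖P‖ + 1)); linarith
    · calc ‖P‖ * min (c / 2) (c / 2 / (‖P‖ + 1)) ≤ (‖P‖ + 1) * (c / 2 / (‖P‖ + 1)) := by
            gcongr
            · linarith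
            · exact min_le_right _ _
        _ = c / 2 := by field_simp
  let T : Set A := S ∩ Metric.ball h ε
  have hT : T ∈ 𝓝[S] h := Filter.inter_mem self_mem_nhdsWithin
    (mem_nhdsWithin_of_mem_nhds (Metric.ball_mem_nhds _ hε))
  have hdim := hnb T hT
  let f : T → lieAlg S hS := fun x => π (star h * x)
  have nm : ∀ u ∈ S, ∀ x : A, ‖star u * x‖ = ‖x‖ := fun u hu x =>
    CStarRing.norm_coe_unitary_mul ⟨star u, hS.unit _ (hS.star _ hu)⟩ x
  have hanti : AntilipschitzWith (Real.toNNReal (2 / c)) f := by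
    refine AntilipschitzWith.of_le_mul_dist ?_
    rintro ⟨x, hxS, hx⟩ ⟨y, hyS, hy⟩
    rw [Real.coe_toNNReal _ (by positivity), Subtype.dist_eq, dist_eq_norm, dist_eq_norm]
    simp only [f]
    rw [← map_sub, ← mul_sub]
    have hyu := Unitary.mem_iff.1 (hS.unit y hyS)
    have hhu := Unitary.mem_iff.1 (hS.unit h hh)
    have e1 : star y * (x - y) = star y * x - 1 := by rw [mul_sub, hyu.1]
    have e2 : star h * (x - y) = (star y * x - 1) + (star h * (y - h)) * (star y * x - 1) := by
      rw [mul_sub (star h) y h, hhu.1, ← e1]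
      have : star h * y * (star y * (x - y)) = star h * (x - y) := by
        rw [mul_assoc, ← mul_assoc y, hyu.2, one_mul]
      rw [sub_mul, this, one_mul]; abel
    have n1 : ‖star y * x - 1‖ = ‖x - y‖ := by rw [← e1, nm y hyS]
    have hx' : ‖x - h‖ < ε := by simpa [dist_eq_norm] using hx
    have hy' : ‖y - h‖ < ε := by simpa [dist_eq_norm] using hy
    have n2 : ‖x - y‖ < c := by
      calc ‖x - y‖ = ‖(x - h) - (y - h)‖ := by simp
        _ ≤ ‖x - h‖ + ‖y - h‖ := norm_sub_le _ _
        _ < c := by linarith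
    have n3 := hlow _ (hS.mul _ (hS.star _ hyS) _ hxS) (by rw [n1]; exact n2)
    rw [n1] at n3
    have n4 : ‖P ((star h * (y - h)) * (star y * x - 1))‖ ≤ c / 2 * ‖x - y‖ := by
      calc _ ≤ ‖P‖ * ‖(star h * (y - h)) * (star y * x - 1)‖ := P.le_opNorm _
        _ ≤ ‖P‖ * (‖star h * (y - h)‖ * ‖star y * x - 1‖) := by
            gcongr; exact norm_mul_le _ _
        _ = ‖P‖ * ‖y - h‖ * ‖x - y‖ := by rw [nm h hh, n1]; ring
        _ ≤ ‖P‖ * ε * ‖x - y‖ := by gcongr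
        _ ≤ _ := by gcongr
    rw [e2, map_add]
    rw [hP] at n4
    have n5 := norm_sub_le (π (star y * x - 1) + π ((star h * (y - h)) * (star y * x - 1)))
      (π ((star h * (y - h)) * (star y * x - 1)))
    rw [add_sub_cancel_right] at n5
    have n6 : c / 2 * ‖x - y‖ ≤
      ‖π (star y * x - 1) + π ((star h * (y - h)) * (star y * x - 1))‖ := by linarith
    calc ‖x - y‖ = 2 / c * (c / 2 * ‖x - y‖) := by field_simp
      _ ≤ _ := by gcongr
  have d1 : dimH T = dimH (Set.univ : Set T) := by
    have := (isometry_subtype_coe (s := T)).dimH_image Set.univ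
    simpa using this
  have d2 := hanti.le_dimH_image Set.univ
  have d3 : dimH (f '' Set.univ) ≤ dimH (Set.univ : Set (lieAlg S hS)) := dimH_mono (Set.subset_univ _)
  rw [Real.dimH_univ_eq_finrank] at d3
  exact absurd hdim (not_lt.2 (d1.le.trans (d2.trans d3)))

end Generic


section Mat

open scoped Matrix.Norms.L2Operator

lemma finrank_self_eq_skew {A : Type*} [CStarAlgebra A] [FiniteDimensional ℝ A] :
    Module.finrank ℝ (selfAdjoint A) = Module.finrank ℝ (skewAdjoint A) := by
  have hb : Function.Bijective (skewAdjoint.negISMul (A := A)) := by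
    constructor
    · intro x y h
      ext
      rw [← skewAdjoint.I_smul_neg_I x, h, skewAdjoint.I_smul_neg_I y]
    · intro y
      refine ⟨⟨Complex.I • (y : A), ?_⟩, ?_⟩
      · rw [skewAdjoint.mem_iff, star_smul, y.2.star_eq]; simp
      · ext; simp [skewAdjoint.negISMul, smul_smul]
  exact (LinearEquiv.ofBijective _ hb).finrank_eq.symm

lemma two_mul_finrank_skew {A : Type*} [CStarAlgebra A] [FiniteDimensional ℝ A] :
    2 * Module.finrank ℝ (skewAdjoint A) = Module.finrank ℝ A := by
  have h := (StarModule.decomposeProdAdjoint ℝ A).finrank_eq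
  have : FiniteDimensional ℝ (selfAdjoint A) :=
    inferInstanceAs (FiniteDimensional ℝ (selfAdjoint.submodule ℝ A))
  have : FiniteDimensional ℝ (skewAdjoint A) :=
    inferInstanceAs (FiniteDimensional ℝ (skewAdjoint.submodule ℝ A))
  rw [Module.finrank_prod, finrank_self_eq_skew] at h
  omega

instance (m : ℕ) : FiniteDimensional ℝ (Matrix (Fin m) (Fin m) ℂ) :=
  FiniteDimensional.trans ℝ ℂ _

lemma finrank_skew (m : ℕ) :
    Module.finrank ℝ (skewAdjoint.submodule ℝ (Matrix (Fin m) (Fin m) ℂ)) = m ^ 2 := by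
  have h : 2 * Module.finrank ℝ (skewAdjoint.submodule ℝ (Matrix (Fin m) (Fin m) ℂ)) = _ :=
    two_mul_finrank_skew (A := Matrix (Fin m) (Fin m) ℂ)
  have h2 : Module.finrank ℝ (Matrix (Fin m) (Fin m) ℂ) = 2 * m ^ 2 := by
    rw [← Module.finrank_mul_finrank ℝ ℂ, Complex.finrank_real_complex, Module.finrank_matrix]
    simp [pow_two]
  omega

lemma le_dimH_unitary {A : Type*} [CStarAlgebra A] [FiniteDimensional ℝ A] :
    (Module.finrank ℝ (skewAdjoint.submodule ℝ A) : ENNReal) ≤ dimH (unitary A : Set A) := by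
  let _ := CStarAlgebra.spectralOrder A
  have _ := CStarAlgebra.spectralOrderedRing A
  have e : Module.finrank ℝ (selfAdjoint.submodule ℝ A)
    = Module.finrank ℝ (skewAdjoint.submodule ℝ A) := finrank_self_eq_skew (A := A)
  rw [← e]
  let R : A →ₗ[ℝ] selfAdjoint.submodule ℝ A := realPart
  let R' := LinearMap.toContinuousLinearMap R
  have h1 := R'.lipschitz.dimH_image_le (unitary A : Set A)
  refine le_trans ?_ h1
  rw [← Real.dimH_of_mem_nhds (Metric.closedBall_mem_nhds (0 : selfAdjoint.submodule ℝ A) one_pos)]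
  refine dimH_mono fun a ha => ?_
  have ha' : ‖a‖ ≤ 1 := by simpa using ha
  exact ⟨selfAdjoint.unitarySelfAddISMul a ha', (selfAdjoint.unitarySelfAddISMul a ha').2,
    selfAdjoint.realPart_unitarySelfAddISMul a ha'⟩

variable {m : ℕ}

lemma re_trace_self {X : Matrix (Fin m) (Fin m) ℂ} (hX : X ∈ skewAdjoint (Matrix (Fin m) (Fin m) ℂ))
    (h : (X * X).trace.re = 0) : X = 0 := by
  open scoped ComplexOrder in
  have hs : X.conjTranspose = -X := (skewAdjoint.mem_iff).1 hX
  have hp := (Matrix.posSemidef_conjTranspose_mul_self X).trace_nonneg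
  rw [← Matrix.trace_conjTranspose_mul_self_eq_zero_iff]
  have him := (Complex.nonneg_iff.1 hp).2
  apply Complex.ext
  · rw [hs, neg_mul, Matrix.trace_neg]; simp [h]
  · simpa using him.symm

/-- the trace form -/
noncomputable def trForm (m : ℕ) :
    LinearMap.BilinForm ℝ (skewAdjoint.submodule ℝ (Matrix (Fin m) (Fin m) ℂ)) :=
  LinearMap.mk₂ ℝ (fun X Y => ((X : Matrix (Fin m) (Fin m) ℂ) * (Y : Matrix (Fin m) (Fin m) ℂ)).trace.re)
    (by intro a b c; simp [add_mul])
    (by intro r a b; simp)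
    (by intro a b c; simp [mul_add])
    (by intro r a b; simp)

lemma trForm_apply (X Y : skewAdjoint.submodule ℝ (Matrix (Fin m) (Fin m) ℂ)) :
    trForm m X Y = ((X : Matrix (Fin m) (Fin m) ℂ) * (Y : Matrix (Fin m) (Fin m) ℂ)).trace.re := rfl

lemma trForm_refl : (trForm m).IsRefl := by
  intro x y h
  rw [trForm_apply] at *
  rwa [Matrix.trace_mul_comm]

lemma trForm_nondeg : (trForm m).Nondegenerate := by
  constructor
  · intro x h
    exact Subtype.ext (re_trace_self x.2 (h x))
  · intro x h
    exact Subtype.ext (re_trace_self x.2 (h x))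

lemma bracket_skew {X Y : Matrix (Fin m) (Fin m) ℂ}
    (hX : X ∈ skewAdjoint (Matrix (Fin m) (Fin m) ℂ))
    (hY : Y ∈ skewAdjoint (Matrix (Fin m) (Fin m) ℂ)) :
    Y * X - X * Y ∈ skewAdjoint (Matrix (Fin m) (Fin m) ℂ) := by
  rw [skewAdjoint.mem_iff] at *
  rw [star_sub, star_mul, star_mul, hX, hY]
  noncomm_ring

lemma trace_bracket (X Y Z : Matrix (Fin m) (Fin m) ℂ) :
    (X * (Y * Z - Z * Y)).trace = ((X * Y - Y * X) * Z).trace := by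
  rw [mul_sub, sub_mul, Matrix.trace_sub, Matrix.trace_sub, ← mul_assoc, ← mul_assoc,
    Matrix.trace_mul_comm (X * Z) Y, ← mul_assoc]

lemma scalar_of_commute_skew {a : Matrix (Fin m) (Fin m) ℂ}
    (h : ∀ Y ∈ skewAdjoint (Matrix (Fin m) (Fin m) ℂ), Y * a - a * Y = 0) :
    ∃ c : ℂ, a = c • 1 := by
  have h1 : ∀ Z : Matrix (Fin m) (Fin m) ℂ, Commute Z a := by
    intro Z
    have hs : ∀ s : selfAdjoint (Matrix (Fin m) (Fin m) ℂ), Commute (s : Matrix (Fin m) (Fin m) ℂ) a := by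
      intro s
      have := h (Complex.I • (s : Matrix (Fin m) (Fin m) ℂ))
        (by rw [skewAdjoint.mem_iff, star_smul, s.2.star_eq]; simp)
      rw [smul_mul_assoc, mul_smul_comm, ← smul_sub, smul_eq_zero] at this
      exact sub_eq_zero.1 (this.resolve_left Complex.I_ne_zero)
    rw [← realPart_add_I_smul_imaginaryPart Z]
    exact (hs _).add_left ((hs _).smul_left _)
  obtain ⟨c, hc⟩ := Matrix.mem_range_scalar_of_commute_single (M := a) (fun i j _ => h1 _)
  exact ⟨c, by rw [← hc]; simp [Matrix.smul_one_eq_diagonal]⟩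

lemma exists_smul_of_finrank_le_one {V : Type*} [AddCommGroup V] [Module ℝ V]
    [FiniteDimensional ℝ V] (P : Submodule ℝ V) (hP : Module.finrank ℝ P ≤ 1)
    {a Z : V} (ha : a ∈ P) (hz : a ≠ 0) (hZ : Z ∈ P) : ∃ r : ℝ, r • a = Z := by
  obtain ⟨v, hv⟩ := finrank_le_one_iff.1 hP
  obtain ⟨r, hr⟩ := hv ⟨a, ha⟩
  obtain ⟨s, hs⟩ := hv ⟨Z, hZ⟩
  have hr0 : r ≠ 0 := by
    rintro rfl
    apply hz
    simpa using (congrArg Subtype.val hr).symm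
  refine ⟨s * r⁻¹, ?_⟩
  have h1 := congrArg Subtype.val hr
  have h2 := congrArg Subtype.val hs
  simp only [Submodule.coe_smul] at h1 h2
  rw [← h1, ← h2, smul_smul, mul_assoc, inv_mul_cancel₀ hr0, mul_one]

lemma traceless_mem (g : Submodule ℝ (Matrix (Fin m) (Fin m) ℂ))
    (hle : g ≤ skewAdjoint.submodule ℝ (Matrix (Fin m) (Fin m) ℂ))
    (hbr : ∀ X ∈ g, ∀ Y ∈ g, Y * X - X * Y ∈ g)
    (hdim : m ^ 2 - 1 ≤ Module.finrank ℝ g)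
    {X : Matrix (Fin m) (Fin m) ℂ} (hX : X ∈ skewAdjoint (Matrix (Fin m) (Fin m) ℂ))
    (htr : X.trace = 0) : X ∈ g := by
  let V := skewAdjoint.submodule ℝ (Matrix (Fin m) (Fin m) ℂ)
  let W : Submodule ℝ V := g.comap V.subtype
  have hW : Module.finrank ℝ W = Module.finrank ℝ g :=
    (Submodule.comapSubtypeEquivOfLe hle).finrank_eq
  have horth : Module.finrank ℝ ((trForm m).orthogonal W) ≤ 1 := by
    rw [LinearMap.BilinForm.finrank_orthogonal trForm_nondeg, hW, finrank_skew]
    omega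
  have hzero : ∀ a ∈ (trForm m).orthogonal W, a ≠ 0 → ∀ Z ∈ (trForm m).orthogonal W,
      trForm m a Z = 0 → Z = 0 := by
    intro a ha hz Z hZ h0
    have : ∃ r : ℝ, r • a = Z := exists_smul_of_finrank_le_one _ horth ha hz hZ
    obtain ⟨r, hr⟩ := this
    have h2 : trForm m Z Z = 0 := by
      nth_rewrite 1 [← hr]
      rw [map_smul, LinearMap.smul_apply, h0, smul_zero]
    exact Subtype.ext (re_trace_self Z.2 h2)
  have hXW : (⟨X, hX⟩ : V) ∈ W := by
    rw [← LinearMap.BilinForm.orthogonal_orthogonal trForm_nondeg trForm_refl W]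
    intro a ha
    change trForm m a ⟨X, hX⟩ = 0
    by_cases ha0 : a = 0
    · rw [ha0]; simp
    have haW : ∀ Y ∈ W, trForm m Y a = 0 := fun Y hY => ha Y hY
    -- brackets with `a`
    have hself : ∀ Y : V, trForm m a ⟨_, bracket_skew a.2 Y.2⟩ = 0 := by
      intro Y
      rw [trForm_apply]
      simp only
      rw [mul_sub, Matrix.trace_sub, ← mul_assoc, ← mul_assoc,
        Matrix.trace_mul_comm (_ * (Y : Matrix (Fin m) (Fin m) ℂ)), ← mul_assoc]
      simp
    have s1 : ∀ Y ∈ W, (⟨_, bracket_skew a.2 Y.2⟩ : V) = 0 := by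
      intro Y hY
      refine hzero a ha ha0 _ ?_ (hself Y)
      intro Z hZ
      change trForm m Z _ = 0
      rw [trForm_apply]
      simp only
      rw [trace_bracket]
      exact haW ⟨_, bracket_skew Y.2 Z.2⟩ (hbr _ hY _ hZ)
    have s2 : ∀ Y : V, (⟨_, bracket_skew a.2 Y.2⟩ : V) = 0 := by
      intro Y
      refine hzero a ha ha0 _ ?_ (hself Y)
      intro Z hZ
      change trForm m Z _ = 0
      rw [trForm_apply]
      simp only
      have e1 := congrArg Subtype.val (s1 Z hZ)
      simp only [ZeroMemClass.coe_zero] at e1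
      have e2 := trace_bracket (Z : Matrix (Fin m) (Fin m) ℂ) a Y
      rw [e1, zero_mul, Matrix.trace_zero, mul_sub, Matrix.trace_sub] at e2
      rw [mul_sub, Matrix.trace_sub, ← neg_sub, e2]
      simp
    obtain ⟨c, hc⟩ := scalar_of_commute_skew (a := (a : Matrix (Fin m) (Fin m) ℂ))
      (fun Y hY => congrArg Subtype.val (s2 ⟨Y, hY⟩))
    rw [trForm_apply, hc]
    simp [htr]
  exact hXW

lemma det_exp_skew {X : Matrix (Fin m) (Fin m) ℂ}
    (hX : X ∈ skewAdjoint (Matrix (Fin m) (Fin m) ℂ)) :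
    (exp X).det = Complex.exp X.trace := by
  have hH : ((-Complex.I) • X).IsHermitian := by
    have : star X = -X := (skewAdjoint.mem_iff).1 hX
    change star ((-Complex.I) • X) = _
    rw [star_smul, this]; simp
  have h1 := hH.spectral_theorem
  have htr := hH.trace_eq_sum_eigenvalues
  set U := hH.eigenvectorUnitary
  set d := hH.eigenvalues
  rw [Unitary.conjStarAlgAut_apply] at h1
  have hUU := Unitary.mem_iff.1 U.2
  let u : (Matrix (Fin m) (Fin m) ℂ)ˣ := ⟨U, star U, hUU.2, hUU.1⟩
  have h2 : X = (u : Matrix (Fin m) (Fin m) ℂ) * Matrix.diagonal (fun i => Complex.I * (d i : ℂ)) *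
      ((u⁻¹ : (Matrix (Fin m) (Fin m) ℂ)ˣ) : Matrix (Fin m) (Fin m) ℂ) := by
    have h3 : X = Complex.I • ((-Complex.I) • X) := by simp [smul_smul]
    have h4 : Matrix.diagonal (fun i => Complex.I * (d i : ℂ))
      = Complex.I • Matrix.diagonal (RCLike.ofReal ∘ d : Fin m → ℂ) := by
      rw [← Matrix.diagonal_smul]; rfl
    rw [h3, h1, h4]
    simp [u]
  have h5 : X.trace = ∑ i, Complex.I * (d i : ℂ) := by
    rw [Matrix.trace_smul] at htr
    rw [← Finset.mul_sum]
    change _ = Complex.I * ∑ i, ((d i : ℝ) : ℂ)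
    have : (∑ i, ((d i : ℝ) : ℂ)) = -Complex.I • X.trace := htr.symm
    rw [this]
    simp [← mul_assoc]
  rw [h5, Complex.exp_sum]
  conv_lhs => rw [h2, Matrix.exp_units_conj, Matrix.exp_diagonal, Matrix.det_units_conj,
    Matrix.det_diagonal]
  refine Finset.prod_congr rfl fun i _ => ?_
  rw [Pi.coe_exp, Complex.exp_eq_exp_ℂ]

lemma exists_skew_exp {u : Matrix (Fin m) (Fin m) ℂ}
    (hu : u ∈ unitary (Matrix (Fin m) (Fin m) ℂ)) :
    ∃ X ∈ skewAdjoint (Matrix (Fin m) (Fin m) ℂ), exp X = u := by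
  obtain ⟨θ, hθ⟩ : ∃ θ : ℝ, -Complex.exp (θ * Complex.I) ∉ spectrum ℂ u := by
    by_contra! hcon
    have hfin := Matrix.finite_spectrum u
    have hinj : Set.InjOn (fun θ : ℝ => -Complex.exp (θ * Complex.I)) (Set.Ioc (-Real.pi) Real.pi) := by
      intro x hx y hy h
      simp only [neg_inj] at h
      have h1 := Complex.arg_exp_mul_I x
      have h2 := Complex.arg_exp_mul_I y
      rw [h, h2] at h1
      have hx' : x ∈ Set.Ioc (-Real.pi) (-Real.pi + 2 * Real.pi) := ⟨hx.1, by linarith [hx.2]⟩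
      have hy' : y ∈ Set.Ioc (-Real.pi) (-Real.pi + 2 * Real.pi) := ⟨hy.1, by linarith [hy.2]⟩
      rw [(toIocMod_eq_self Real.two_pi_pos).2 hx', (toIocMod_eq_self Real.two_pi_pos).2 hy'] at h1
      exact h1.symm
    have hinf : (Set.Ioc (-Real.pi) Real.pi).Infinite :=
      Set.Ioc_infinite (by linarith [Real.pi_pos])
    exact (hinf.image hinj) (hfin.subset (by rintro _ ⟨x, _, rfl⟩; exact hcon x))
  set z := Complex.exp (θ * Complex.I) with hz
  have hz0 : z ≠ 0 := Complex.exp_ne_zero _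
  have hzn : star z * z = 1 := by
    rw [mul_comm]
    simp [Complex.mul_conj, Complex.normSq_eq_norm_sq, hz, Complex.norm_exp_ofReal_mul_I]
  have hv : star z • u ∈ unitary (Matrix (Fin m) (Fin m) ℂ) := by
    rw [Unitary.mem_iff] at *
    rw [star_smul, smul_mul_smul_comm, smul_mul_smul_comm, hu.1, hu.2, star_star, hzn, mul_comm, hzn]
    simp
  have hsp : (-1 : ℂ) ∉ spectrum ℂ (star z • u) := by
    intro h
    apply hθ
    have h2 := (spectrum.smul_mem_smul_iff (r := Units.mk0 z hz0)).2 h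
    simp only [Units.smul_mk0, smul_eq_mul, smul_smul] at h2
    rw [mul_comm z (star z), hzn] at h2
    simpa using h2
  have hlt := (Unitary.norm_sub_one_lt_two_iff hv).2 hsp
  have he := expUnitary_argSelfAdjoint (u := ⟨_, hv⟩) hlt
  have he2 := congrArg Subtype.val he
  rw [selfAdjoint.expUnitary_coe] at he2
  set a := Unitary.argSelfAdjoint (⟨_, hv⟩ : unitary (Matrix (Fin m) (Fin m) ℂ))
  have e1 : exp ((θ * Complex.I) • (1 : Matrix (Fin m) (Fin m) ℂ)) = z • 1 := by
    rw [Matrix.smul_one_eq_diagonal, Matrix.exp_diagonal, Matrix.smul_one_eq_diagonal]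
    congr 1
    ext i
    rw [Pi.coe_exp, hz, Complex.exp_eq_exp_ℂ]
  refine ⟨(θ * Complex.I) • (1 : Matrix (Fin m) (Fin m) ℂ) + Complex.I • (a : Matrix (Fin m) (Fin m) ℂ), ?_, ?_⟩
  · refine AddSubgroup.add_mem _ ?_ ?_
    · rw [skewAdjoint.mem_iff, star_smul]; simp
    · rw [skewAdjoint.mem_iff, star_smul, a.2.star_eq]; simp
  · rw [Matrix.exp_add_of_commute _ _ ((Commute.one_left _).smul_left _), e1, he2]
    simp only [smul_mul_assoc, one_mul, smul_smul]
    rw [mul_comm, hzn, one_smul]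

lemma su_subset (hm : 0 < m) {S : Set (Matrix (Fin m) (Fin m) ℂ)} (hS : CG S)
    (hsu : ∀ X ∈ skewAdjoint (Matrix (Fin m) (Fin m) ℂ), X.trace = 0 → X ∈ lieAlg S hS)
    {u : Matrix (Fin m) (Fin m) ℂ} (hu : u ∈ unitary (Matrix (Fin m) (Fin m) ℂ))
    (hdet : u.det = 1) : u ∈ S := by
  obtain ⟨X, hX, rfl⟩ := exists_skew_exp hu
  have hm0 : (m : ℂ) ≠ 0 := by exact_mod_cast hm.ne'
  rw [det_exp_skew hX, Complex.exp_eq_one_iff] at hdet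
  obtain ⟨k, hk⟩ := hdet
  set τ : ℂ := X.trace / m with hτ
  have hτs : star τ = -τ := by
    have : star X.trace = -X.trace := by
      rw [← Matrix.trace_conjTranspose, ← Matrix.star_eq_conjTranspose, (skewAdjoint.mem_iff).1 hX,
        Matrix.trace_neg]
    rw [hτ, star_div₀, this]
    simp [neg_div]
  have hexpS : ∀ Y ∈ skewAdjoint (Matrix (Fin m) (Fin m) ℂ), Y.trace = 0 → exp Y ∈ S := by
    intro Y hY h
    simpa using hsu Y hY h 1
  let D : Matrix (Fin m) (Fin m) ℂ :=
    Matrix.diagonal (fun j => τ - if j = ⟨0, hm⟩ then k * (2 * Real.pi * Complex.I) else 0)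
  have hD : exp D ∈ S := by
    apply hexpS
    · simp only [D]
      rw [skewAdjoint.mem_iff, Matrix.star_eq_conjTranspose, Matrix.diagonal_conjTranspose,
        Matrix.diagonal_neg]
      congr 1
      ext j
      simp only [Pi.star_apply, star_sub, hτs, Pi.neg_apply]
      split_ifs <;> simp <;> ring
    · simp only [D, Matrix.trace_diagonal, Finset.sum_sub_distrib, Finset.sum_const,
        Finset.sum_ite_eq', Finset.mem_univ, if_true, Finset.card_univ, Fintype.card_fin]
      rw [← hk, hτ, nsmul_eq_mul]
      field_simp
      simp
  have hD2 : exp D = exp (τ • (1 : Matrix (Fin m) (Fin m) ℂ)) := by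
    rw [Matrix.smul_one_eq_diagonal, Matrix.exp_diagonal, Matrix.exp_diagonal]
    congr 1
    ext j
    rw [Pi.coe_exp, Pi.coe_exp, ← Complex.exp_eq_exp_ℂ]
    split_ifs
    · rw [Complex.exp_sub, Complex.exp_int_mul_two_pi_mul_I, div_one]
    · simp
  have hX0 : exp (X - τ • (1 : Matrix (Fin m) (Fin m) ℂ)) ∈ S := by
    apply hexpS
    · refine AddSubgroup.sub_mem _ hX ?_
      rw [skewAdjoint.mem_iff, star_smul, hτs]; simp
    · rw [Matrix.trace_sub, Matrix.trace_smul, Matrix.trace_one, hτ]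
      simp
      field_simp
      simp
  have : exp X = exp (X - τ • (1 : Matrix (Fin m) (Fin m) ℂ)) * exp D := by
    rw [hD2, ← Matrix.exp_add_of_commute _ _ ((Commute.one_right _).smul_right _), sub_add_cancel]
  rw [this]
  exact hS.mul _ hX0 _ hD

end Mat

section Final
open scoped Matrix.Norms.L2Operator

variable {m : ℕ}

lemma cg_of_closed (G : Subgroup (Matrix.unitaryGroup (Fin m) ℂ))
    (hclosed : IsClosed (G : Set (Matrix.unitaryGroup (Fin m) ℂ))) :
    CG (Subtype.val '' (G : Set (Matrix.unitaryGroup (Fin m) ℂ)) :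
      Set (Matrix (Fin m) (Fin m) ℂ)) where
  closed := by
    have h : IsClosed ((Matrix.unitaryGroup (Fin m) ℂ : Set (Matrix (Fin m) (Fin m) ℂ))) :=
      isClosed_unitary
    exact h.isClosedEmbedding_subtypeVal.isClosedMap _ hclosed
  one := ⟨1, G.one_mem, rfl⟩
  mul := by
    rintro _ ⟨a, ha, rfl⟩ _ ⟨b, hb, rfl⟩
    exact ⟨a * b, G.mul_mem ha hb, rfl⟩
  star := by
    rintro _ ⟨a, ha, rfl⟩
    exact ⟨a⁻¹, G.inv_mem ha, rfl⟩
  unit := by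
    rintro _ ⟨a, ha, rfl⟩
    exact a.2

lemma dimH_carrier (G : Subgroup (Matrix.unitaryGroup (Fin m) ℂ)) :
    dimH (unitarySubgroupCarrier m G) =
      dimH (Subtype.val '' (G : Set (Matrix.unitaryGroup (Fin m) ℂ)) :
        Set (Matrix (Fin m) (Fin m) ℂ)) := by
  have h := ((Matrix.ofLinearEquiv ℝ : (Fin m → Fin m → ℂ) ≃ₗ[ℝ]
    Matrix (Fin m) (Fin m) ℂ).toContinuousLinearEquiv).dimH_image (unitarySubgroupCarrier m G)
  rw [← h]
  congr 1
  rw [unitarySubgroupCarrier, Set.image_image]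
  rfl

lemma lieAlg_le_skew {S : Set (Matrix (Fin m) (Fin m) ℂ)} (hS : CG S) :
    lieAlg S hS ≤ skewAdjoint.submodule ℝ (Matrix (Fin m) (Fin m) ℂ) :=
  fun _ hX => skew_of_mem_lieSet hS hX

lemma su_le (hm : 2 ≤ m) (G : Subgroup (Matrix.unitaryGroup (Fin m) ℂ))
    (hclosed : IsClosed (G : Set (Matrix.unitaryGroup (Fin m) ℂ)))
    (hdim : ((m ^ 2 - 1 : ℕ) : ENNReal) ≤ dimH (unitarySubgroupCarrier m G))
    (B : Matrix.unitaryGroup (Fin m) ℂ) (hB : (B : Matrix (Fin m) (Fin m) ℂ).det = 1) :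
    B ∈ G := by
  have hS := cg_of_closed G hclosed
  rw [dimH_carrier] at hdim
  have h1 : m ^ 2 - 1 ≤ Module.finrank ℝ (lieAlg _ hS) := by
    exact_mod_cast hdim.trans (dimH_le_finrank hS)
  have h2 := su_subset (by omega) hS (fun X hX htr => traceless_mem (lieAlg _ hS)
    (lieAlg_le_skew hS) (fun X hX Y hY => bracket_mem hS hX hY) h1 hX htr) B.2 hB
  obtain ⟨b, hb, hbB⟩ := h2
  rwa [← Subtype.ext hbB]

lemma norm_det (B : Matrix.unitaryGroup (Fin m) ℂ) :
    ‖(B : Matrix (Fin m) (Fin m) ℂ).det‖ = 1 :=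
  CStarRing.norm_of_mem_unitary (Matrix.det_of_mem_unitary B.2)

lemma exists_re_det (G : Subgroup (Matrix.unitaryGroup (Fin m) ℂ))
    (hconn : IsConnected (G : Set (Matrix.unitaryGroup (Fin m) ℂ)))
    {B₀ : Matrix.unitaryGroup (Fin m) ℂ} (hB₀ : B₀ ∈ G)
    {c : ℝ} (h1 : (B₀ : Matrix (Fin m) (Fin m) ℂ).det.re ≤ c) (h2 : c ≤ 1) :
    ∃ B ∈ G, (B : Matrix (Fin m) (Fin m) ℂ).det.re = c := by
  have hcont : Continuous (fun B : Matrix.unitaryGroup (Fin m) ℂ =>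
      (B : Matrix (Fin m) (Fin m) ℂ).det.re) :=
    Complex.continuous_re.comp (Continuous.matrix_det continuous_subtype_val)
  have h3 := hconn.isPreconnected.intermediate_value hB₀ G.one_mem hcont.continuousOn
  exact h3 ⟨h1, by simpa using h2⟩

lemma exists_det_exp_small (G : Subgroup (Matrix.unitaryGroup (Fin m) ℂ))
    (hconn : IsConnected (G : Set (Matrix.unitaryGroup (Fin m) ℂ)))
    {B₀ : Matrix.unitaryGroup (Fin m) ℂ} (hB₀ : B₀ ∈ G)
    {t : ℝ} (h1 : (B₀ : Matrix (Fin m) (Fin m) ℂ).det.re ≤ Real.cos t) :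
    ∃ B ∈ G, (B : Matrix (Fin m) (Fin m) ℂ).det = Complex.exp (t * Complex.I) := by
  obtain ⟨B, hB, hre⟩ := exists_re_det G hconn hB₀ h1 (Real.cos_le_one t)
  have hn := norm_det B
  set z := (B : Matrix (Fin m) (Fin m) ℂ).det with hz
  have h2 : z.re * z.re + z.im * z.im = 1 := by
    rw [← Complex.normSq_apply, Complex.normSq_eq_norm_sq, hn, one_pow]
  have h3 : z.im ^ 2 = Real.sin t ^ 2 := by
    rw [hre] at h2
    nlinarith [Real.sin_sq_add_cos_sq t]
  rcases sq_eq_sq_iff_eq_or_eq_neg.1 h3 with h | h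
  · refine ⟨B, hB, ?_⟩
    rw [← hz]
    apply Complex.ext
    · rw [Complex.exp_ofReal_mul_I_re, hre]
    · rw [Complex.exp_ofReal_mul_I_im, h]
  · refine ⟨B⁻¹, G.inv_mem hB, ?_⟩
    have : ((B⁻¹ : Matrix.unitaryGroup (Fin m) ℂ) : Matrix (Fin m) (Fin m) ℂ).det = star z := by
      rw [hz, ← Matrix.det_conjTranspose]; rfl
    rw [this]
    apply Complex.ext
    · rw [Complex.exp_ofReal_mul_I_re]; simpa using hre
    · rw [Complex.exp_ofReal_mul_I_im]; simp [h]

lemma exists_det (G : Subgroup (Matrix.unitaryGroup (Fin m) ℂ))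
    (hconn : IsConnected (G : Set (Matrix.unitaryGroup (Fin m) ℂ)))
    {B₀ : Matrix.unitaryGroup (Fin m) ℂ} (hB₀ : B₀ ∈ G)
    (hne : (B₀ : Matrix (Fin m) (Fin m) ℂ).det ≠ 1) {z : ℂ} (hz : ‖z‖ = 1) :
    ∃ B ∈ G, (B : Matrix (Fin m) (Fin m) ℂ).det = z := by
  have hlt : (B₀ : Matrix (Fin m) (Fin m) ℂ).det.re < 1 := by
    have hn := norm_det B₀
    refine lt_of_le_of_ne (hn ▸ Complex.re_le_norm _) fun h => hne ?_
    have h2 : ((B₀ : Matrix (Fin m) (Fin m) ℂ).det).re * ((B₀ : Matrix (Fin m) (Fin m) ℂ).det).re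
        + ((B₀ : Matrix (Fin m) (Fin m) ℂ).det).im * ((B₀ : Matrix (Fin m) (Fin m) ℂ).det).im = 1 := by
      rw [← Complex.normSq_apply, Complex.normSq_eq_norm_sq, hn, one_pow]
    apply Complex.ext
    · simpa using h
    · rw [h] at h2
      simp only [Complex.one_im]
      nlinarith
  have hlim : Tendsto (fun n : ℕ => Real.cos (z.arg / n)) atTop (𝓝 1) := by
    have := (Real.continuous_cos.tendsto 0).comp (tendsto_const_div_atTop_nhds_zero_nat z.arg)
    rw [Real.cos_zero] at this
    exact this
  obtain ⟨n, hn, hn0⟩ := ((hlim.eventually (lt_mem_nhds hlt)).and (eventually_gt_atTop 0)).exists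
  obtain ⟨B, hB, hdet⟩ := exists_det_exp_small G hconn hB₀ hn.le
  refine ⟨B ^ n, G.pow_mem hB n, ?_⟩
  have hnC : (n : ℂ) ≠ 0 := by exact_mod_cast hn0.ne'
  have : ((B ^ n : Matrix.unitaryGroup (Fin m) ℂ) : Matrix (Fin m) (Fin m) ℂ)
      = (B : Matrix (Fin m) (Fin m) ℂ) ^ n := rfl
  rw [this, Matrix.det_pow, hdet, ← Complex.exp_nat_mul]
  have h5 : (n : ℂ) * (((z.arg / n : ℝ) : ℂ) * Complex.I) = z.arg * Complex.I := by
    push_cast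
    field_simp
  rw [h5]
  have := Complex.norm_mul_exp_arg_mul_I z
  simpa [hz] using this

lemma dichotomy (G : Subgroup (Matrix.unitaryGroup (Fin m) ℂ))
    (hconn : IsConnected (G : Set (Matrix.unitaryGroup (Fin m) ℂ)))
    (hsu : ∀ B : Matrix.unitaryGroup (Fin m) ℂ, (B : Matrix (Fin m) (Fin m) ℂ).det = 1 → B ∈ G) :
    (∀ B : Matrix.unitaryGroup (Fin m) ℂ,
        B ∈ G ↔ (B : Matrix (Fin m) (Fin m) ℂ).det = 1) ∨ G = ⊤ := by
  by_cases h : ∀ B ∈ G, (B : Matrix (Fin m) (Fin m) ℂ).det = 1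
  · exact Or.inl fun B => ⟨h B, hsu B⟩
  · right
    push Not at h
    obtain ⟨B₀, hB₀, hne⟩ := h
    rw [eq_top_iff]
    intro U _
    obtain ⟨B, hB, hdet⟩ := exists_det G hconn hB₀ hne (norm_det U)
    have h1 : U * B⁻¹ ∈ G := by
      apply hsu
      have h2 : U * B⁻¹ * B = U := by group
      have h3 := congrArg (fun V : Matrix.unitaryGroup (Fin m) ℂ =>
        (V : Matrix (Fin m) (Fin m) ℂ).det) h2
      have h4 : ((U * B⁻¹ * B : Matrix.unitaryGroup (Fin m) ℂ) : Matrix (Fin m) (Fin m) ℂ)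
        = ((U * B⁻¹ : Matrix.unitaryGroup (Fin m) ℂ) : Matrix (Fin m) (Fin m) ℂ) * B := rfl
      simp only [h4, Matrix.det_mul] at h3
      have h0 : (U : Matrix (Fin m) (Fin m) ℂ).det ≠ 0 := by
        intro h; have := norm_det U; rw [h] at this; simp at this
      rw [hdet] at h3
      have h3' := mul_right_cancel₀ h0 (h3.trans (one_mul _).symm)
      exact h3'
    have := G.mul_mem h1 hB
    simpa using this

lemma dim_top : dimH (unitarySubgroupCarrier m ⊤) = ((m ^ 2 : ℕ) : ENNReal) := by
  have hS := cg_of_closed (⊤ : Subgroup (Matrix.unitaryGroup (Fin m) ℂ)) (by simp)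
  rw [dimH_carrier]
  apply le_antisymm
  · refine (dimH_le_finrank hS).trans ?_
    have := Submodule.finrank_mono (lieAlg_le_skew hS)
    rw [finrank_skew] at this
    exact_mod_cast this
  · have h := le_dimH_unitary (A := Matrix (Fin m) (Fin m) ℂ)
    rw [finrank_skew] at h
    refine h.trans (dimH_mono ?_)
    intro x hx
    exact ⟨⟨x, hx⟩, by simp, rfl⟩

lemma dim_su (hm : 2 ≤ m) (G : Subgroup (Matrix.unitaryGroup (Fin m) ℂ))
    (hclosed : IsClosed (G : Set (Matrix.unitaryGroup (Fin m) ℂ)))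
    (hG : ∀ B ∈ G, (B : Matrix (Fin m) (Fin m) ℂ).det = 1) :
    dimH (unitarySubgroupCarrier m G) ≤ ((m ^ 2 - 1 : ℕ) : ENNReal) := by
  have hS := cg_of_closed G hclosed
  rw [dimH_carrier]
  refine (dimH_le_finrank hS).trans ?_
  have htr : ∀ X ∈ lieAlg _ hS, X.trace = 0 := by
    intro X hX
    have hsk := skew_of_mem_lieSet hS hX
    have h1 : ∀ t : ℝ, Complex.exp (t * X.trace) = 1 := by
      intro t
      obtain ⟨B, hB, hBe⟩ := mem_lieAlg.1 hX t
      have h2 := hG B hB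
      rw [hBe, det_exp_skew ((skewAdjoint.submodule ℝ _).smul_mem t hsk), Matrix.trace_smul] at h2
      simpa using h2
    have h3 : HasDerivAt (fun t : ℝ => Complex.exp (t * X.trace)) (Complex.exp ((0 : ℝ) * X.trace) * (1 * X.trace)) 0 :=
      ((Complex.ofRealCLM.hasDerivAt (x := (0:ℝ))).mul_const X.trace).cexp
    have h4 : HasDerivAt (fun t : ℝ => Complex.exp (t * X.trace)) 0 0 := by
      simp only [h1]
      exact hasDerivAt_const _ _
    simpa using h3.unique h4
  have hlt : lieAlg _ hS < skewAdjoint.submodule ℝ (Matrix (Fin m) (Fin m) ℂ) := by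
    refine lt_of_le_of_ne (lieAlg_le_skew hS) fun h => ?_
    have h1 : Complex.I • (1 : Matrix (Fin m) (Fin m) ℂ) ∈
        skewAdjoint.submodule ℝ (Matrix (Fin m) (Fin m) ℂ) := by
      change _ ∈ skewAdjoint _
      rw [skewAdjoint.mem_iff, star_smul]; simp
    rw [← h] at h1
    have h2 := htr _ h1
    rw [Matrix.trace_smul, Matrix.trace_one] at h2
    simp at h2
    omega
  have h := Submodule.finrank_lt_finrank_of_lt hlt
  rw [finrank_skew] at h
  have : Module.finrank ℝ (lieAlg _ hS) ≤ m ^ 2 - 1 := by omega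
  exact_mod_cast this

lemma invariant_unitary (hm : 2 ≤ m) (p : Submodule ℂ (Fin m → ℂ))
    (hp : ∀ B : Matrix.unitaryGroup (Fin m) ℂ, (B : Matrix (Fin m) (Fin m) ℂ).det = 1 →
      ∀ x ∈ p, (B : Matrix (Fin m) (Fin m) ℂ).mulVec x ∈ p)
    (U : Matrix (Fin m) (Fin m) ℂ) (hU : U ∈ unitary (Matrix (Fin m) (Fin m) ℂ))
    {x : Fin m → ℂ} (hx : x ∈ p) : U.mulVec x ∈ p := by
  have hn : ‖U.det‖ = 1 := norm_det ⟨U, hU⟩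
  obtain ⟨c, hc⟩ := IsAlgClosed.exists_pow_nat_eq (U.det)⁻¹ (n := m) (by omega)
  have hcn : ‖c‖ = 1 := by
    have := congrArg norm hc
    rw [norm_pow, norm_inv, hn, inv_one] at this
    exact (pow_eq_one_iff_of_nonneg (norm_nonneg _) (by omega)).1 this
  have hc0 : c ≠ 0 := by rintro rfl; simp at hcn
  have hcc : star c * c = 1 := by
    rw [mul_comm]
    simp [Complex.mul_conj, Complex.normSq_eq_norm_sq, hcn]
  have hV : c • U ∈ unitary (Matrix (Fin m) (Fin m) ℂ) := by
    rw [Unitary.mem_iff] at *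
    rw [star_smul, smul_mul_smul_comm, smul_mul_smul_comm, hU.1, hU.2, hcc, mul_comm, hcc]
    simp
  have h0 : U.det ≠ 0 := by intro h; rw [h] at hn; simp at hn
  have h1 := hp ⟨c • U, hV⟩ (by
    simp only [Matrix.det_smul, Fintype.card_fin, hc]
    exact inv_mul_cancel₀ h0) x hx
  simp only [Matrix.smul_mulVec] at h1
  exact (p.smul_mem_iff hc0).1 h1

open scoped ComplexOrder in
lemma star_dot_ne_zero {u : Fin m → ℂ} (hu : u ≠ 0) : star u ⬝ᵥ u ≠ 0 := by
  intro h
  exact hu (dotProduct_star_self_eq_zero.1 h)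

lemma householder_unitary {u : Fin m → ℂ} (hu : u ≠ 0) :
    (1 : Matrix (Fin m) (Fin m) ℂ) - (2 / (star u ⬝ᵥ u)) • Matrix.vecMulVec u (star u)
      ∈ unitary (Matrix (Fin m) (Fin m) ℂ) := by
  have h0 : star u ⬝ᵥ u ≠ 0 := by
    exact star_dot_ne_zero ‹_›
  set s := star u ⬝ᵥ u with hs
  have hss : star s = s := by
    rw [hs]
    simp [dotProduct, star_sum, mul_comm]
  set P := Matrix.vecMulVec u (star u) with hP
  have hPs : star P = P := by
    rw [hP, Matrix.star_eq_conjTranspose, Matrix.conjTranspose_vecMulVec, star_star]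
  have hPP : P * P = s • P := by
    rw [hP, Matrix.vecMulVec_mul_vecMulVec, Matrix.vecMulVec_smul]
  have hst : star ((1 : Matrix (Fin m) (Fin m) ℂ) - (2 / s) • P) = 1 - (2 / s) • P := by
    rw [star_sub, star_one, star_smul, hPs, star_div₀, hss]; simp
  have hmul : ((1 : Matrix (Fin m) (Fin m) ℂ) - (2 / s) • P) * (1 - (2 / s) • P) = 1 := by
    rw [sub_mul, mul_sub, mul_sub, smul_mul_smul_comm, hPP, smul_smul]
    have : 2 / s * (2 / s) * s = 2 / s + 2 / s := by field_simp; norm_num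
    rw [this, add_smul]
    simp
  rw [Unitary.mem_iff, hst]
  exact ⟨hmul, hmul⟩

lemma irreducible (hm : 2 ≤ m) (p : Submodule ℂ (Fin m → ℂ))
    (hp : ∀ B : Matrix.unitaryGroup (Fin m) ℂ, (B : Matrix (Fin m) (Fin m) ℂ).det = 1 →
      ∀ x ∈ p, (B : Matrix (Fin m) (Fin m) ℂ).mulVec x ∈ p) : p = ⊥ ∨ p = ⊤ := by
  by_cases hbot : p = ⊥
  · exact Or.inl hbot
  right
  obtain ⟨x, hx, hx0⟩ := p.ne_bot_iff.1 hbot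
  have key : ∀ u : Fin m → ℂ, star u ⬝ᵥ x ≠ 0 → u ∈ p := by
    intro u hux
    have hu : u ≠ 0 := by rintro rfl; simp at hux
    have h0 : star u ⬝ᵥ u ≠ 0 := by
      exact star_dot_ne_zero ‹_›
    have h1 := invariant_unitary hm p hp _ (householder_unitary hu) hx
    rw [Matrix.sub_mulVec, Matrix.one_mulVec, Matrix.smul_mulVec, Matrix.vecMulVec_mulVec] at h1
    have h2 := p.sub_mem hx h1
    rw [sub_sub_cancel, op_smul_eq_smul, smul_smul] at h2
    exact (p.smul_mem_iff (mul_ne_zero (div_ne_zero two_ne_zero h0) hux)).1 h2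
  rw [eq_top_iff]
  intro u _
  by_cases h : star u ⬝ᵥ x = 0
  · have h1 := key (u + x) (by
      rw [star_add, add_dotProduct, h, zero_add]
      exact star_dot_ne_zero ‹_›)
    simpa using p.sub_mem h1 hx
  · exact key u h

end Final

end Stmt9

/-- A closed connected subgroup `G` of `U(m)` (`m ≥ 2`) of dimension at
least `m² - 1` has dimension exactly `m² - 1` or `m²`; it is `SU(m)` (up to conjugacy,
which for `SU(m)` means equality) or all of `U(m)`, and in either case it acts
irreducibly on `ℂ^m` by the standard representation. -/
theorem stmt9 {m : ℕ} (hm : 2 ≤ m)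
    (G : Subgroup (Matrix.unitaryGroup (Fin m) ℂ))
    (hclosed : IsClosed (G : Set (Matrix.unitaryGroup (Fin m) ℂ)))
    (hconn : IsConnected (G : Set (Matrix.unitaryGroup (Fin m) ℂ)))
    (hdim : ((m ^ 2 - 1 : ℕ) : ℝ≥0∞) ≤ dimH (unitarySubgroupCarrier m G)) :
    (dimH (unitarySubgroupCarrier m G) = ((m ^ 2 - 1 : ℕ) : ℝ≥0∞) ∨
      dimH (unitarySubgroupCarrier m G) = ((m ^ 2 : ℕ) : ℝ≥0∞)) ∧
    ((∀ B : Matrix.unitaryGroup (Fin m) ℂ,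
        B ∈ G ↔ (B : Matrix (Fin m) (Fin m) ℂ).det = 1) ∨ G = ⊤) ∧
    (∀ p : Submodule ℂ (Fin m → ℂ),
      (∀ B ∈ G, ∀ x ∈ p, (B : Matrix (Fin m) (Fin m) ℂ).mulVec x ∈ p) →
      p = ⊥ ∨ p = ⊤) := by
  have hsu := Stmt9.su_le hm G hclosed hdim
  have hdich := Stmt9.dichotomy G hconn hsu
  refine ⟨?_, hdich, fun p hp => Stmt9.irreducible hm p fun B hB => hp B (hsu B hB)⟩
  rcases hdich with h | h
  · exact Or.inl (le_antisymm (Stmt9.dim_su hm G hclosed fun B hB => (h B).1 hB) hdim)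
  · right
    rw [h]
    exact Stmt9.dim_top
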